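/- arXiv:1705.05466 — 2 statements merged into one kernel-verified Lean document; each statement's English description precedes it below -/
import Mathlib

section
/- Let N be a type III factor on a separable Hilbert space. For every finite set {ψ_1,...,ψ_k} of normal states of N and every ε ∈ (0, √5 − 2), there exist projections P_0,...,P_4 ∈ N with P_i P_{i+1} = 0 (indices mod 5) such that ψ_l(P_0 + P_1 + P_2 + P_3 + P_4) ≥ √5 − ε > 2 for every l. -/
open scoped ComplexOrder InnerProductSpace

/-- `p` is a projection belonging to the von Neumann algebra `N`. -/
def IsProjectionIn {H : Type*} [NormedAddCommGroup H] [InnerProductSpace ℂ H]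
    [CompleteSpace H] (N : VonNeumannAlgebra H) (p : H →L[ℂ] H) : Prop :=
  p ∈ N ∧ IsSelfAdjoint p ∧ p * p = p

/-- A normal state of a von Neumann algebra on `H`: a functional given by a
density matrix, i.e. by a square-summable sequence of vectors. -/
def IsNormalState {H : Type*} [NormedAddCommGroup H] [InnerProductSpace ℂ H]
    [CompleteSpace H] (ψ : (H →L[ℂ] H) → ℂ) : Prop :=
  ∃ ξ : ℕ → H, (∑' n, (‖ξ n‖ : ℝ) ^ 2) = 1 ∧ ∀ B : H →L[ℂ] H, ψ B = ∑' n, ⟪ξ n, B (ξ n)⟫_ℂ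

/-- `N` is a factor: its center is trivial. -/
def IsFactor {H : Type*} [NormedAddCommGroup H] [InnerProductSpace ℂ H]
    [CompleteSpace H] (N : VonNeumannAlgebra H) : Prop :=
  ∀ x ∈ N, (∀ y ∈ N, x * y = y * x) → ∃ c : ℂ, x = c • (1 : H →L[ℂ] H)

/-- `N` is a type III factor: a factor in which every nonzero projection `p`
is infinite, i.e. Murray–von Neumann equivalent to a proper subprojection of
itself. -/
def IsTypeIIIFactor {H : Type*} [NormedAddCommGroup H] [InnerProductSpace ℂ H]
    [CompleteSpace H] (N : VonNeumannAlgebra H) : Prop :=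
  IsFactor N ∧ ∀ p : H →L[ℂ] H, IsProjectionIn N p → p ≠ 0 →
    ∃ v ∈ N, star v * v = p ∧ (v * star v) * p = v * star v ∧ v * star v ≠ p


section Aux
variable {H : Type*} [NormedAddCommGroup H] [InnerProductSpace ℂ H] [CompleteSpace H]

/-- The projection onto the closed span of `S`. -/
noncomputable def projOn (S : Set H) : H →L[ℂ] H :=
  (Submodule.span ℂ S).topologicalClosure.starProjection

lemma projOn_isSelfAdjoint (S : Set H) : IsSelfAdjoint (projOn S) :=
  isSelfAdjoint_starProjection _

lemma projOn_idem (S : Set H) : projOn S * projOn S = projOn S :=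
  Submodule.isIdempotentElem_starProjection _

lemma projOn_apply_mem {S : Set H} {s : H} (hs : s ∈ S) : projOn S s = s :=
  Submodule.starProjection_eq_self_iff.2
    (Submodule.le_topologicalClosure _ (Submodule.subset_span hs))

lemma vanish_closure {S : Set H} {z : H →L[ℂ] H} (hz : ∀ s ∈ S, z s = 0) {x : H}
    (hx : x ∈ (Submodule.span ℂ S).topologicalClosure) : z x = 0 := by
  have h1 : (Submodule.span ℂ S).topologicalClosure ≤ LinearMap.ker z.toLinearMap := by
    apply Submodule.topologicalClosure_minimal
    · rw [Submodule.span_le]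
      intro s hs
      simpa using hz s hs
    · exact z.isClosed_ker
  simpa using h1 hx

lemma mul_projOn {S : Set H} {z : H →L[ℂ] H} (hz : ∀ s ∈ S, z s = 0) : z * projOn S = 0 := by
  ext x
  exact vanish_closure hz (Submodule.starProjection_apply_mem _ x)

lemma projOn_mem {N : VonNeumannAlgebra H} {S : Set H}
    (hS : ∀ y ∈ N.commutant, ∀ s ∈ S, projOn S (y s) = y s) : projOn S ∈ N := by
  have h1 : ∀ y ∈ N.commutant, projOn S * y * projOn S = y * projOn S := by
    intro y hy
    have := mul_projOn (S := S) (z := projOn S * y - y) (by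
      intro s hs; simp [hS y hy s hs])
    rw [sub_mul, sub_eq_zero] at this
    exact this
  have h2 : ∀ y ∈ N.commutant, projOn S * y = y * projOn S := by
    intro y hy
    have h3 := congrArg star (h1 (star y) (star_mem hy))
    simp only [star_mul, star_star, (projOn_isSelfAdjoint S).star_eq] at h3
    rw [← h3, ← mul_assoc, h1 y hy]
  rw [← N.commutant_commutant, VonNeumannAlgebra.mem_commutant_iff]
  intro y hy
  exact (h2 y hy).symm

lemma projOn_isProjectionIn {N : VonNeumannAlgebra H} {S : Set H}
    (hS : ∀ y ∈ N.commutant, ∀ s ∈ S, projOn S (y s) = y s) : IsProjectionIn N (projOn S) :=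
  ⟨projOn_mem hS, projOn_isSelfAdjoint S, projOn_idem S⟩

/-- In a factor, two nonzero projections are not centrally orthogonal. -/
lemma exists_ne_zero {N : VonNeumannAlgebra H} (hN : IsFactor N) {p f : H →L[ℂ] H}
    (hp : IsProjectionIn N p) (hp0 : p ≠ 0) (hf0 : f ≠ 0) :
    ∃ x ∈ N, f * x * p ≠ 0 := by
  by_contra! hcon
  let S : Set H := {s | ∃ x ∈ N, ∃ ξ, s = x (p ξ)}
  have hmem : projOn S ∈ N := by
    apply projOn_mem
    rintro y hy s ⟨x, hx, ξ, rfl⟩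
    apply projOn_apply_mem
    refine ⟨x, hx, y ξ, ?_⟩
    have h1 := (VonNeumannAlgebra.mem_commutant_iff.1 hy) x hx
    have h2 := (VonNeumannAlgebra.mem_commutant_iff.1 hy) p hp.1
    have h1' := congrArg (fun T : H →L[ℂ] H => T (p ξ)) h1
    have h2' := congrArg (fun T : H →L[ℂ] H => T ξ) h2
    simp only [mul_apply_eq_comp] at h1' h2'
    rw [← h1', h2']
  have hmem' : projOn S ∈ N.commutant := by
    apply projOn_mem
    rw [VonNeumannAlgebra.commutant_commutant]
    rintro y hy s ⟨x, hx, ξ, rfl⟩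
    apply projOn_apply_mem
    exact ⟨y * x, mul_mem hy hx, ξ, rfl⟩
  obtain ⟨c, hc⟩ := hN _ hmem (fun y hy =>
    ((VonNeumannAlgebra.mem_commutant_iff.1 hmem') y hy).symm)
  have hpp : projOn S * p = p := by
    ext ξ
    exact projOn_apply_mem ⟨1, one_mem N, ξ, rfl⟩
  have hfz : f * projOn S = 0 := by
    apply mul_projOn
    rintro s ⟨x, hx, ξ, rfl⟩
    exact congrArg (fun T : H →L[ℂ] H => T ξ) (hcon x hx)
  rw [hc] at hpp hfz
  have hc0 : c = 0 := by
    have : c • f = 0 := by simpa using hfz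
    exact (smul_eq_zero.1 this).resolve_right hf0
  apply hp0
  rw [← hpp, hc0]; simp

lemma cfc_mem_vN {N : VonNeumannAlgebra H} {a : H →L[ℂ] H} (ha : a ∈ N) (f : ℝ → ℝ) :
    cfc f a ∈ N := by
  rw [← N.commutant_commutant, VonNeumannAlgebra.mem_commutant_iff]
  intro y hy
  have h : Commute a y := (VonNeumannAlgebra.mem_commutant_iff.1 hy) a ha
  exact (h.cfc_real f).symm

lemma comparability {N : VonNeumannAlgebra H} (hN : IsFactor N) {p f : H →L[ℂ] H}
    (hp : IsProjectionIn N p) (hf : IsProjectionIn N f) (hp0 : p ≠ 0) (hf0 : f ≠ 0) :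
    ∃ e w : H →L[ℂ] H, IsProjectionIn N e ∧ e ≠ 0 ∧ p * e = e ∧ w ∈ N ∧ star w * w = e ∧
      f * w = w := by
  obtain ⟨x, hx, hy0⟩ := exists_ne_zero hN hp hp0 hf0
  set y := f * x * p with hy
  have hyN : y ∈ N := mul_mem (mul_mem hf.1 hx) hp.1
  set a := star y * y with ha
  have haN : a ∈ N := mul_mem (star_mem hyN) hyN
  have ha0 : a ≠ 0 := by
    rw [ha]; exact (CStarRing.star_mul_self_ne_zero_iff y).2 hy0
  have hann : 0 ≤ a := star_mul_self_nonneg y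
  have hasa : IsSelfAdjoint a := .star_mul_self y
  have : Nontrivial (H →L[ℂ] H) := ⟨⟨a, 0, ha0⟩⟩
  have hδ : 0 < ‖a‖ / 2 := by have := norm_pos_iff.2 ha0; linarith
  set δ := ‖a‖ / 2 with hδdef
  have hmaxpos : ∀ t : ℝ, 0 < max t δ := fun t => lt_max_of_lt_right hδ
  let h : ℝ → ℝ := fun t => max (t - δ) 0
  let g : ℝ → ℝ := fun t => (Real.sqrt (max t δ))⁻¹
  let m : ℝ → ℝ := fun t => max (t - δ) 0 / max t δ
  have hh : Continuous h := by fun_prop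
  have hg : Continuous g := by
    apply Continuous.inv₀ (by fun_prop)
    intro t; exact (Real.sqrt_pos.2 (hmaxpos t)).ne'
  have hm : Continuous m := by
    apply Continuous.div (by fun_prop) (by fun_prop)
    intro t; exact (hmaxpos t).ne'
  have h_ne : cfc h a ≠ 0 := by
    intro h0
    have h1 : ‖a‖ ∈ spectrum ℝ a := CStarAlgebra.norm_mem_spectrum_of_nonneg hann
    have h2 : h ‖a‖ ∈ spectrum ℝ (cfc h a) := by
      rw [cfc_map_spectrum (R := ℝ) h a hasa hh.continuousOn]
      exact ⟨_, h1, rfl⟩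
    rw [h0, spectrum.zero_eq] at h2
    have h3 : max (‖a‖ - δ) 0 = 0 := h2
    have : ‖a‖ - δ ≤ 0 := by rw [← h3]; exact le_max_left _ _
    linarith
  let S : Set H := Set.range (cfc h a : H →L[ℂ] H)
  have hSp : projOn S ∈ N := by
    apply projOn_mem
    rintro z hz s ⟨ξ, rfl⟩
    apply projOn_apply_mem
    refine ⟨z ξ, ?_⟩
    exact congrArg (fun T : H →L[ℂ] H => T ξ)
      ((VonNeumannAlgebra.mem_commutant_iff.1 hz) _ (cfc_mem_vN haN h))
  have hpe : projOn S * cfc h a = cfc h a := by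
    ext ξ; exact projOn_apply_mem ⟨ξ, rfl⟩
  have hpa : p * a = a := by
    rw [ha, hy]; simp only [star_mul, hp.2.1.star_eq, ← mul_assoc, hp.2.2]
  have hha : cfc h a = a * cfc m a := by
    have e0 : a * cfc m a = cfc (fun t => t * m t) a := by
      rw [cfc_mul (fun t => t) m a continuous_id.continuousOn hm.continuousOn, cfc_id' ℝ a]
    rw [e0]
    apply cfc_congr
    intro t ht
    simp only [h, m]
    rcases le_total t δ with h1 | h1
    · rw [max_eq_right (by linarith)]; simp
    · rw [max_eq_left h1]
      have : t ≠ 0 := by linarith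
      field_simp
  have hext : ∀ z : H →L[ℂ] H, z * cfc h a = cfc h a → z * projOn S = projOn S := by
    intro z hz
    have := mul_projOn (S := S) (z := z - 1) (by
      rintro s ⟨ξ, rfl⟩
      have := congrArg (fun T : H →L[ℂ] H => T ξ) hz
      simp only [mul_apply_eq_comp] at this
      simp [this])
    rw [sub_mul, sub_eq_zero, one_mul] at this
    exact this
  refine ⟨projOn S, y * cfc g a * projOn S, ⟨hSp, projOn_isSelfAdjoint S, projOn_idem S⟩,
    ?_, ?_, mul_mem (mul_mem hyN (cfc_mem_vN haN g)) hSp, ?_, ?_⟩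
  · intro h0; rw [h0, zero_mul] at hpe; exact h_ne hpe.symm
  · apply hext; rw [hha, ← mul_assoc, hpa]
  · have hgs : star (cfc g a) = cfc g a := (cfc_predicate g a : IsSelfAdjoint _).star_eq
    have h1 : cfc g a * a * cfc g a * cfc h a = cfc h a := by
      have e1 : cfc g a * a * cfc g a * cfc h a
          = cfc (fun t => g t * t * g t * h t) a := by
        rw [cfc_mul (fun t => g t * t * g t) h a
            ((hg.mul continuous_id).mul hg).continuousOn hh.continuousOn,
          cfc_mul (fun t => g t * t) g a (hg.mul continuous_id).continuousOn hg.continuousOn,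
          cfc_mul g (fun t => t) a hg.continuousOn continuous_id.continuousOn, cfc_id' ℝ a]
      rw [e1]
      apply cfc_congr
      intro t ht
      simp only [h, g]
      rcases le_total t δ with h1 | h1
      · rw [max_eq_right (a := t - δ) (by linarith)]; simp
      · rw [max_eq_left h1]
        have : 0 < t := by linarith
        have h2 : (Real.sqrt t)⁻¹ * t * (Real.sqrt t)⁻¹ = 1 := by
          have h3 := Real.mul_self_sqrt this.le
          have h4 := (Real.sqrt_pos.2 this).ne'
          field_simp
          nlinarith
        rw [h2, one_mul]
    have h2 := hext _ h1
    simp only [star_mul, (projOn_isSelfAdjoint S).star_eq, hgs]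
    calc projOn S * (cfc g a * star y) * (y * cfc g a * projOn S)
        = projOn S * (cfc g a * (star y * y) * cfc g a * projOn S) := by
          simp only [mul_assoc]
      _ = projOn S := by rw [← ha, h2, projOn_idem]
  · rw [hy]; simp only [← mul_assoc, hf.2.2]

end Aux

section Aux2
variable {H : Type*} [NormedAddCommGroup H] [InnerProductSpace ℂ H] [CompleteSpace H]

lemma norm_sq_apply_eq (x : H →L[ℂ] H) (ξ : H) :
    ‖x ξ‖ ^ 2 = (⟪ξ, (star x * x) ξ⟫_ℂ).re := by
  rw [mul_apply_eq_comp, ContinuousLinearMap.star_eq_adjoint,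
    ContinuousLinearMap.adjoint_inner_right]
  exact (inner_self_eq_norm_sq (𝕜 := ℂ) (x ξ)).symm

lemma norm_sq_proj {e : H →L[ℂ] H} (h1 : IsSelfAdjoint e) (h2 : e * e = e) (ξ : H) :
    ‖e ξ‖ ^ 2 = (⟪ξ, e ξ⟫_ℂ).re := by
  rw [norm_sq_apply_eq, h1.star_eq, h2]

lemma pow_cancel {A : Type*} [Ring A] {u v q w : A} (huv : u * v = q) (hqv : q * v = v)
    (hw : q * w = w) (n : ℕ) : u ^ n * (v ^ n * w) = w ∧ q * (v ^ n * w) = v ^ n * w := by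
  induction n with
  | zero => simp [hw]
  | succ n ih =>
    refine ⟨?_, ?_⟩
    · rw [pow_succ u, pow_succ' v, mul_assoc, mul_assoc v, ← mul_assoc u v, huv, ih.2, ih.1]
    · rw [pow_succ' v, mul_assoc v, ← mul_assoc q v, hqv]

lemma exists_small {N : VonNeumannAlgebra H} (hN : IsTypeIIIFactor N)
    (h10 : (1 : H →L[ℂ] H) ≠ 0) (X : Finset H) {η : ℝ} (hη : 0 < η) :
    ∃ q : H →L[ℂ] H, IsProjectionIn N q ∧ q ≠ 0 ∧ ∀ ξ ∈ X, ‖q ξ‖ < η := by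
  obtain ⟨v, hvN, hv1, -, hv2⟩ := hN.2 1 ⟨one_mem N, IsSelfAdjoint.one _, one_mul 1⟩ h10
  let r : ℕ → (H →L[ℂ] H) := fun n => v ^ n * (1 - v * star v) * star v ^ n
  have hc : ∀ n, star v ^ n * v ^ n = 1 := by
    intro n
    have := (pow_cancel (w := 1) hv1 (one_mul v) (one_mul 1) n).1
    simpa using this
  have hr0 : (1 - v * star v) * (1 - v * star v) = 1 - v * star v := by
    have : v * star v * (v * star v) = v * star v := by
      rw [mul_assoc, ← mul_assoc (star v), hv1, one_mul]
    rw [mul_sub, sub_mul, sub_mul, this]; simp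
  have hrsa : ∀ n, IsSelfAdjoint (r n) := by
    intro n
    simp only [r, IsSelfAdjoint, star_mul, star_pow, star_star, star_sub, star_one, mul_assoc]
  have hrid : ∀ n, r n * r n = r n := by
    intro n
    calc r n * r n = v ^ n * (1 - v * star v) * (star v ^ n * v ^ n) *
          (1 - v * star v) * star v ^ n := by simp only [r, mul_assoc]
      _ = v ^ n * ((1 - v * star v) * (1 - v * star v)) * star v ^ n := by
          rw [hc, mul_one]; simp only [mul_assoc]
      _ = r n := by rw [hr0]
  have hrN : ∀ n, r n ∈ N := fun n =>
    mul_mem (mul_mem (pow_mem hvN n) (sub_mem (one_mem N) (mul_mem hvN (star_mem hvN))))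
      (pow_mem (star_mem hvN) n)
  have hrne : ∀ n, r n ≠ 0 := by
    intro n h0
    have : star v ^ n * r n * v ^ n = 1 - v * star v := by
      calc star v ^ n * r n * v ^ n = (star v ^ n * v ^ n) * (1 - v * star v) *
          (star v ^ n * v ^ n) := by simp only [r, mul_assoc]
        _ = _ := by rw [hc]; simp
    rw [h0, mul_zero, zero_mul] at this
    exact hv2 (sub_eq_zero.1 this.symm).symm
  have hnorm : ∀ n ξ, ‖r n ξ‖ ^ 2 = ‖(star v ^ n) ξ‖ ^ 2 - ‖(star v ^ (n + 1)) ξ‖ ^ 2 := by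
    intro n ξ
    rw [norm_sq_proj (hrsa n) (hrid n), norm_sq_apply_eq, norm_sq_apply_eq]
    have : r n = star (star v ^ n) * star v ^ n - star (star v ^ (n + 1)) * star v ^ (n + 1) := by
      rw [star_pow, star_pow, star_star, pow_succ v, pow_succ' (star v)]
      simp only [r, mul_sub, sub_mul, mul_one, mul_assoc]
    rw [this, sub_apply, inner_sub_right, Complex.sub_re]
  have hlim : ∀ ξ, Filter.Tendsto (fun n => ‖r n ξ‖ ^ 2) Filter.atTop (nhds 0) := by
    intro ξ
    have hanti : Antitone (fun n => ‖(star v ^ n) ξ‖ ^ 2) := by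
      apply antitone_nat_of_succ_le
      intro n
      have := hnorm n ξ
      have h2 := sq_nonneg ‖r n ξ‖
      linarith
    have hbdd : BddBelow (Set.range (fun n => ‖(star v ^ n) ξ‖ ^ 2)) :=
      ⟨0, by rintro _ ⟨n, rfl⟩; positivity⟩
    have hl := tendsto_atTop_ciInf hanti hbdd
    have hl2 := hl.sub (hl.comp (Filter.tendsto_add_atTop_nat 1))
    rw [sub_self] at hl2
    refine hl2.congr ?_
    intro n
    simp only [Function.comp]
    exact (hnorm n ξ).symm
  have hev : ∀ᶠ n in Filter.atTop, ∀ ξ ∈ X, ‖r n ξ‖ ^ 2 < η ^ 2 := by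
    rw [Filter.eventually_all_finset]
    intro ξ _
    exact (hlim ξ).eventually_lt_const (by positivity)
  obtain ⟨n, hn⟩ := hev.exists
  exact ⟨r n, ⟨hrN n, hrsa n, hrid n⟩, hrne n, fun ξ hξ => lt_of_pow_lt_pow_left₀ 2 hη.le (hn ξ hξ)⟩

lemma finite_sum_equiv {N : VonNeumannAlgebra H} {v q r : H →L[ℂ] H} (hvN : v ∈ N)
    (hv : star v * v = q) (hqv : q * v = v) (hqr : q * r = r) (hur : star v * r = 0)
    (F : Finset (H →L[ℂ] H)) (hF : ∀ e ∈ F, ∃ w ∈ N, star w * w = e ∧ r * w = w) :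
    ∃ (w : H →L[ℂ] H) (n : ℕ), w ∈ N ∧ star w * w = ∑ e ∈ F, e ∧ q * w = w ∧
      star v ^ n * w = 0 := by
  classical
  induction F using Finset.induction_on with
  | empty => exact ⟨0, 0, zero_mem N, by simp, by simp, by simp⟩
  | insert e F he ih =>
    obtain ⟨w, n, hw, h1, h2, h3⟩ := ih (fun e he => hF e (Finset.mem_insert_of_mem he))
    obtain ⟨w', hw', g1, g2⟩ := hF e (Finset.mem_insert_self _ _)
    have g3 : q * w' = w' := by rw [← g2, ← mul_assoc, hqr]
    obtain ⟨g4, g5⟩ := pow_cancel hv hqv g3 n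
    have g6 : star w * v ^ n = 0 := by
      have := congrArg star h3
      simpa using this
    refine ⟨w + v ^ n * w', n + 1, add_mem hw (mul_mem (pow_mem hvN n) hw'), ?_, ?_, ?_⟩
    · rw [Finset.sum_insert he, star_add, star_mul, star_pow, add_mul, mul_add, mul_add, h1,
        ← mul_assoc, g6, mul_assoc, h3, mul_assoc, g4, g1]
      simp [add_comm]
    · rw [mul_add, h2, g5]
    · rw [mul_add, pow_succ', mul_assoc, h3, mul_assoc, g4, ← g2, ← mul_assoc, hur]
      simp

lemma sum_mul_of_mem {S : Set (H →L[ℂ] H)} (hid : ∀ e ∈ S, e * e = e)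
    (hS : S.Pairwise (fun a b => a * b = 0)) (F : Finset (H →L[ℂ] H)) (hF : ↑F ⊆ S)
    {e : H →L[ℂ] H} (he : e ∈ F) : (∑ x ∈ F, x) * e = e := by
  rw [Finset.sum_mul, Finset.sum_eq_single e]
  · exact hid e (hF he)
  · intro b hb hbe
    exact hS (hF hb) (hF he) hbe
  · intro h; exact absurd he h

lemma proj_contract {e : H →L[ℂ] H} (h1 : IsSelfAdjoint e) (h2 : e * e = e) (ξ : H) :
    ‖ξ - e ξ‖ ^ 2 = ‖ξ‖ ^ 2 - ‖e ξ‖ ^ 2 := by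
  rw [@norm_sub_sq ℂ, norm_sq_proj h1 h2]
  simp only [RCLike.re_to_complex]
  ring

lemma key {N : VonNeumannAlgebra H} (hN : IsTypeIIIFactor N)
    (h10 : (1 : H →L[ℂ] H) ≠ 0) (X : Finset H) {η : ℝ} (hη : 0 < η) :
    ∃ e W V : H →L[ℂ] H, IsProjectionIn N e ∧ W ∈ N ∧ V ∈ N ∧ star W * W = e ∧ star V * V = e ∧
      star W * V = 0 ∧ e * W = 0 ∧ e * V = 0 ∧ ∀ ξ ∈ X, ‖ξ - e ξ‖ < η := by
  classical
  obtain ⟨q, hq, hq0, hqX⟩ := exists_small hN h10 X (half_pos hη)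
  obtain ⟨v, hvN, hv, hvq, hvne⟩ := hN.2 q hq hq0
  have hvq' : v * q = v := by
    have h : star (v - v * q) * (v - v * q) = 0 := by
      rw [star_sub, star_mul, hq.2.1.star_eq, sub_mul, mul_sub, mul_sub, ← mul_assoc (star v), hv,
        mul_assoc q, mul_assoc q, ← mul_assoc (star v), hv]
      simp [hq.2.2]
    exact (sub_eq_zero.1 (CStarRing.star_mul_self_eq_zero_iff _ |>.1 h)).symm
  have hqv : q * v = v := by
    have h := congrArg star hvq
    simp only [star_mul, star_star, hq.2.1.star_eq] at h
    have h2 := congrArg (· * v) h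
    simp only [mul_assoc, hv, hvq'] at h2
    exact h2
  have huq : star v * q = star v := by
    have := congrArg star hqv
    simpa [hq.2.1.star_eq] using this
  have hqu : q * star v = star v := by
    have := congrArg star hvq'
    simpa [hq.2.1.star_eq] using this
  set r := q - v * star v with hr
  have hqr : q * r = r := by rw [hr, mul_sub, hq.2.2, ← mul_assoc, hqv]
  have hur : star v * r = 0 := by rw [hr, mul_sub, huq, ← mul_assoc, hv, hqu, sub_self]
  have hrP : IsProjectionIn N r := by
    refine ⟨sub_mem hq.1 (mul_mem hvN (star_mem hvN)), hq.2.1.sub (.mul_star_self v), ?_⟩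
    nth_rw 1 [hr]
    rw [sub_mul, hqr, mul_assoc, hur, mul_zero, sub_zero]
  have hr0 : r ≠ 0 := fun h => hvne (sub_eq_zero.1 h).symm
  let G : (H →L[ℂ] H) → Prop := fun e =>
    IsProjectionIn N e ∧ q * e = 0 ∧ ∃ w ∈ N, star w * w = e ∧ r * w = w
  obtain ⟨S, hSmax⟩ := zorn_subset
    {S : Set (H →L[ℂ] H) | (∀ e ∈ S, G e) ∧ S.Pairwise (fun a b => a * b = 0)} (by
      intro c hc hchain
      refine ⟨⋃₀ c, ⟨?_, ?_⟩, fun s hs => Set.subset_sUnion_of_mem hs⟩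
      · rintro e ⟨s, hs, he⟩
        exact (hc hs).1 e he
      · exact (Set.pairwise_sUnion hchain.directedOn).2 (fun s hs => (hc hs).2))
  obtain ⟨hSG, hSP⟩ := hSmax.prop
  let T : Set H := {s | ∃ e ∈ S, ∃ ξ, s = e ξ}
  set c := projOn T with hcdef
  have hcP : IsProjectionIn N c := by
    apply projOn_isProjectionIn
    rintro y hy s ⟨e, he, ξ, rfl⟩
    apply projOn_apply_mem
    refine ⟨e, he, y ξ, ?_⟩
    exact (congrArg (fun T : H →L[ℂ] H => T ξ)
      ((VonNeumannAlgebra.mem_commutant_iff.1 hy) e (hSG e he).1.1)).symm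
  have hqc : q * c = 0 := by
    apply mul_projOn
    rintro s ⟨e, he, ξ, rfl⟩
    exact congrArg (fun T : H →L[ℂ] H => T ξ) (hSG e he).2.1
  have hcq : c * q = 0 := by
    have := congrArg star hqc
    simpa [hq.2.1.star_eq, hcP.2.1.star_eq] using this
  have hce : ∀ e ∈ S, c * e = e := by
    intro e he
    ext ξ
    exact projOn_apply_mem ⟨e, he, ξ, rfl⟩
  have hec : ∀ e ∈ S, e * c = e := by
    intro e he
    have := congrArg star (hce e he)
    simpa [(hSG e he).1.2.1.star_eq, hcP.2.1.star_eq] using this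
  have heq : ∀ e ∈ S, e * q = 0 := by
    intro e he
    have := congrArg star (hSG e he).2.1
    simpa [(hSG e he).1.2.1.star_eq, hq.2.1.star_eq] using this
  have hp0 : 1 - q - c = 0 := by
    by_contra hp0
    have hpP : IsProjectionIn N (1 - q - c) := by
      refine ⟨sub_mem (sub_mem (one_mem N) hq.1) hcP.1,
        ((IsSelfAdjoint.one _).sub hq.2.1).sub hcP.2.1, ?_⟩
      simp only [mul_sub, sub_mul, mul_one, one_mul, hq.2.2, hcP.2.2, hqc, hcq]
      abel
    obtain ⟨e, w, he, he0, hpe, hw, hwe, hrw⟩ := comparability hN.1 hpP hrP hp0 hr0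
    have h1 : q * e = 0 := by
      rw [← hpe, ← mul_assoc, mul_sub, mul_sub, hqc, hq.2.2]; simp
    have h2 : ∀ e' ∈ S, e' * e = 0 := by
      intro e' he'
      rw [← hpe, ← mul_assoc, mul_sub, mul_sub, hec e' he', heq e' he']; simp
    have h3 : ∀ e' ∈ S, e * e' = 0 := by
      intro e' he'
      have := congrArg star (h2 e' he')
      simpa [(hSG e' he').1.2.1.star_eq, he.2.1.star_eq] using this
    have hins : insert e S ∈
        {S : Set (H →L[ℂ] H) | (∀ e ∈ S, G e) ∧ S.Pairwise (fun a b => a * b = 0)} := by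
      refine ⟨?_, ?_⟩
      · rintro x (rfl | hx)
        · exact ⟨he, h1, w, hw, hwe, hrw⟩
        · exact hSG x hx
      · exact hSP.insert (fun b hb _ => ⟨h3 b hb, h2 b hb⟩)
    have heS : e ∈ S := hSmax.le_of_ge hins (Set.subset_insert e S) (Set.mem_insert e S)
    have := h2 e heS
    rw [he.2.2] at this
    exact he0 this
  have hid : ∀ e ∈ S, e * e = e := fun e he => (hSG e he).1.2.2
  have hFsa : ∀ F : Finset (H →L[ℂ] H), ↑F ⊆ S → IsSelfAdjoint (∑ e ∈ F, e) := by
    intro F hF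
    simp only [IsSelfAdjoint, star_sum]
    exact Finset.sum_congr rfl (fun e he => (hSG e (hF he)).1.2.1.star_eq)
  have hFid : ∀ F : Finset (H →L[ℂ] H), ↑F ⊆ S →
      (∑ e ∈ F, e) * (∑ e ∈ F, e) = ∑ e ∈ F, e := by
    intro F hF
    rw [Finset.mul_sum]
    exact Finset.sum_congr rfl (fun e he => sum_mul_of_mem hid hSP F hF he)
  have hFc : ∀ F : Finset (H →L[ℂ] H), ↑F ⊆ S → (∑ e ∈ F, e) * c = ∑ e ∈ F, e := by
    intro F hF
    rw [Finset.sum_mul]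
    exact Finset.sum_congr rfl (fun e he => hec e (hF he))
  have hspan : ∀ x ∈ Submodule.span ℂ T, ∃ F : Finset (H →L[ℂ] H), ↑F ⊆ S ∧
      ∀ F' : Finset (H →L[ℂ] H), ↑F' ⊆ S → F ⊆ F' → (∑ e ∈ F', e) x = x := by
    intro x hx
    induction hx using Submodule.span_induction with
    | mem x hx =>
      obtain ⟨e, he, ξ, rfl⟩ := hx
      refine ⟨{e}, by simpa using he, ?_⟩
      intro F' hF' hsub
      exact congrArg (fun T : H →L[ℂ] H => T ξ)
        (sum_mul_of_mem hid hSP F' hF' (hsub (Finset.mem_singleton_self e)))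
    | zero => exact ⟨∅, by simp, by intros; simp⟩
    | add x y _ _ hx hy =>
      obtain ⟨F1, h1, g1⟩ := hx
      obtain ⟨F2, h2, g2⟩ := hy
      refine ⟨F1 ∪ F2, by simp [h1, h2], ?_⟩
      intro F' hF' hsub
      rw [map_add, g1 F' hF' (Finset.union_subset_left hsub),
        g2 F' hF' (Finset.union_subset_right hsub)]
    | smul a x _ hx =>
      obtain ⟨F1, h1, g1⟩ := hx
      refine ⟨F1, h1, ?_⟩
      intro F' hF' hsub
      rw [map_smul, g1 F' hF' hsub]
  have happ : ∀ ξ : H, ∃ F : Finset (H →L[ℂ] H), ↑F ⊆ S ∧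
      ∀ F' : Finset (H →L[ℂ] H), ↑F' ⊆ S → F ⊆ F' → ‖c ξ - (∑ e ∈ F', e) ξ‖ < η / 2 := by
    intro ξ
    have hmem : c ξ ∈ closure (Submodule.span ℂ T : Set H) :=
      Submodule.starProjection_apply_mem (Submodule.span ℂ T).topologicalClosure ξ
    obtain ⟨x, hx, hdist⟩ := Metric.mem_closure_iff.1 hmem (η / 2) (half_pos hη)
    obtain ⟨F, hF, hF2⟩ := hspan x hx
    refine ⟨F, hF, ?_⟩
    intro F' hF' hsub
    have h1 := hF2 F' hF' hsub
    have h2 : c ξ - (∑ e ∈ F', e) ξ = (c ξ - x) - (∑ e ∈ F', e) (c ξ - x) := by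
      rw [map_sub, h1, ← mul_apply_eq_comp, hFc F' hF']
      abel
    rw [dist_eq_norm] at hdist
    have h3 := proj_contract (hFsa F' hF') (hFid F' hF') (c ξ - x)
    rw [h2]
    refine lt_of_le_of_lt ?_ hdist
    refine (pow_le_pow_iff_left₀ (norm_nonneg _) (norm_nonneg _) two_ne_zero).1 ?_
    rw [h3]
    have := sq_nonneg ‖(∑ e ∈ F', e) (c ξ - x)‖
    linarith
  choose Φ hΦ1 hΦ2 using happ
  let F := X.biUnion Φ
  have hFS : ↑F ⊆ S := by
    intro e he
    obtain ⟨ξ, hξ, h⟩ := Finset.mem_biUnion.1 (Finset.mem_coe.1 he)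
    exact hΦ1 ξ h
  obtain ⟨w, n, hw, h1, h2, h3⟩ := finite_sum_equiv hvN hv hqv hqr hur F
    (fun e he => (hSG e (hFS he)).2.2)
  obtain ⟨g4, g5⟩ := pow_cancel hv hqv h2 n
  have hFq : (∑ e ∈ F, e) * q = 0 := by
    rw [Finset.sum_mul]
    exact Finset.sum_eq_zero (fun e he => heq e (hFS he))
  refine ⟨∑ e ∈ F, e, w, v ^ n * w, ⟨sum_mem (fun e he => (hSG e (hFS he)).1.1), hFsa F hFS,
    hFid F hFS⟩, hw, mul_mem (pow_mem hvN n) hw, h1, ?_, ?_, ?_, ?_, ?_⟩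
  · rw [star_mul, star_pow, mul_assoc, g4, h1]
  · have := congrArg star h3
    rw [star_mul, star_pow, star_star, star_zero] at this
    rw [← mul_assoc, this, zero_mul]
  · rw [← h2, ← mul_assoc, hFq, zero_mul]
  · rw [← g5, ← mul_assoc, hFq, zero_mul]
  · intro ξ hξ
    have h5 := hΦ2 ξ F hFS (Finset.subset_biUnion_of_mem Φ hξ)
    have h6 := hqX ξ hξ
    have h7 : ξ = q ξ + c ξ := by
      have := congrArg (fun T : H →L[ℂ] H => T ξ) hp0
      simp only [sub_apply, zero_apply,
        one_apply_eq_self] at this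
      rw [sub_sub, sub_eq_zero] at this
      exact this
    have h8 : ξ - (∑ e ∈ F, e) ξ = q ξ + (c ξ - (∑ e ∈ F, e) ξ) := by
      nth_rw 1 [h7]; abel
    rw [h8]
    refine (norm_add_le _ _).trans_lt ?_
    linarith

end Aux2

/-- The pentagram coordinates. -/
lemma pentagram : ∃ (c : ℝ) (s t : Fin 5 → ℝ), c ^ 2 * 5 = √5 ∧ (∑ i, s i = 0) ∧ (∑ i, t i = 0) ∧
    (∀ i, c * c + s i * s i + t i * t i = 1) ∧
    (∀ i, c * c + s i * s (i + 1) + t i * t (i + 1) = 0) := by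
  have h5 : √5 * √5 = 5 := Real.mul_self_sqrt (by norm_num)
  have h5p : 0 < √5 := by positivity
  have h51 : (1:ℝ) ≤ √5 := Real.one_le_sqrt.2 (by norm_num)
  set A := (1 + √5) / 4 with hA
  have hA' : 4 * A = 1 + √5 := by rw [hA]; ring
  have hA2 : 4 * A ^ 2 = 2 * A + 1 := by rw [hA]; nlinarith
  have hB0 : 0 ≤ 1 - A ^ 2 := by rw [hA]; nlinarith
  set B := √(1 - A ^ 2) with hB
  have hB2 : B * B = 1 - A ^ 2 := Real.mul_self_sqrt hB0
  set c := √(√5 / 5) with hc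
  have hc2 : c * c = √5 / 5 := Real.mul_self_sqrt (by positivity)
  set d := √(1 - √5 / 5) with hd
  have hd2 : d * d = 1 - √5 / 5 := Real.mul_self_sqrt (by nlinarith)
  have hx : c * c = d * d * A := by rw [hc2, hd2, hA]; nlinarith
  have hs : c * c + d * d = 1 := by rw [hc2, hd2]; ring
  refine ⟨c, ![d, -d * A, d * (A - 1 / 2), d * (A - 1 / 2), -d * A],
    ![0, d * B, -(d * B * (2 * A)), d * B * (2 * A), -(d * B)], by rw [sq, hc2]; ring,
    ?_, ?_, ?_, ?_⟩
  · simp [Fin.sum_univ_five]; ring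
  · simp [Fin.sum_univ_five]
  · intro i
    fin_cases i <;> simp
    · linear_combination hs
    · linear_combination hs + d * d * hB2
    · linear_combination hs + d * d * (4 * A ^ 2 * hB2) + d * d * (-A ^ 2 - A / 2 + 3/4) * hA2
    · linear_combination hs + d * d * (4 * A ^ 2 * hB2) + d * d * (-A ^ 2 - A / 2 + 3/4) * hA2
    · linear_combination hs + d * d * hB2
  · intro i
    fin_cases i <;> simp
    · linear_combination hx
    · linear_combination hx - d * d * 2 * A * hB2 + d * d * (A / 2) * hA2
    · linear_combination hx - d * d * 4 * A ^ 2 * hB2 + d * d * (A ^ 2 + A / 2 - 1 / 4) * hA2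
    · linear_combination hx - d * d * 2 * A * hB2 + d * d * (A / 2) * hA2
    · linear_combination hx

section Aux3
variable {H : Type*} [NormedAddCommGroup H] [InnerProductSpace ℂ H] [CompleteSpace H]

lemma inner_mul_star_self (V : H →L[ℂ] H) (ξ : H) :
    ⟪ξ, (V * star V) ξ⟫_ℂ = ((‖star V ξ‖ ^ 2 : ℝ) : ℂ) := by
  rw [mul_apply_eq_comp, ← ContinuousLinearMap.adjoint_inner_left,
    ← ContinuousLinearMap.star_eq_adjoint, inner_self_eq_norm_sq_to_K]
  simp

/-- Pentagram projections in the matrix algebra generated by `e, W, V`. -/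
lemma pentagram_proj {N : VonNeumannAlgebra H} {e W V : H →L[ℂ] H} (he : IsProjectionIn N e)
    (hW : W ∈ N) (hV : V ∈ N) (hWW : star W * W = e) (hVV : star V * V = e)
    (hWV : star W * V = 0) (heW : e * W = 0) (heV : e * V = 0) :
    ∃ (P : Fin 5 → (H →L[ℂ] H)) (g : H → ℝ) (C : ℝ), (∀ i, IsProjectionIn N (P i)) ∧
      (∀ i, P i * P (i + 1) = 0) ∧ (∀ ξ, ⟪ξ, (∑ i, P i) ξ⟫_ℂ = ((g ξ : ℝ) : ℂ)) ∧
      (∀ ξ, √5 * ‖e ξ‖ ^ 2 ≤ g ξ) ∧ (∀ ξ, g ξ ≤ C * ‖ξ‖ ^ 2) := by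
  obtain ⟨c, s, t, hc, hs, ht, h1, h2⟩ := pentagram
  have smem : ∀ (a : ℝ) (x : H →L[ℂ] H), x ∈ N → (a : ℂ) • x ∈ N := fun a x hx =>
    N.toStarSubalgebra.smul_mem hx (a : ℂ)
  let U : Fin 5 → (H →L[ℂ] H) := fun i => (c : ℂ) • e + (s i : ℂ) • W + (t i : ℂ) • V
  have hU : ∀ i, U i ∈ N := fun i =>
    add_mem (add_mem (smem _ _ he.1) (smem _ _ hW)) (smem _ _ hV)
  have hVW : star V * W = 0 := by
    have := congrArg star hWV; simpa using this
  have hWe : star W * e = 0 := by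
    have := congrArg star heW; simpa [he.2.1.star_eq] using this
  have hVe : star V * e = 0 := by
    have := congrArg star heV; simpa [he.2.1.star_eq] using this
  have hsU : ∀ i, star (U i) = (c : ℂ) • e + (s i : ℂ) • star W + (t i : ℂ) • star V := by
    intro i
    simp [U, he.2.1.star_eq]
  have hUU : ∀ i j, star (U i) * U j = ((c * c + s i * s j + t i * t j : ℝ) : ℂ) • e := by
    intro i j
    rw [hsU]
    simp only [U, add_mul, mul_add, smul_mul_smul_comm, he.2.2, hWW, hVV, hWV, hVW, hWe, hVe, heW,
      heV, smul_zero, add_zero, zero_add]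
    rw [← add_smul, ← add_smul]
    push_cast
    rfl
  have hUe : ∀ i, U i * e = U i := by
    have aux : ∀ x : H →L[ℂ] H, star x * x = e → x * e = x := by
      intro x hx
      have h : star (x - x * e) * (x - x * e) = 0 := by
        rw [star_sub, star_mul, he.2.1.star_eq, sub_mul, mul_sub, mul_sub, ← mul_assoc (star x), hx,
          mul_assoc e, mul_assoc e, ← mul_assoc (star x), hx]
        simp [he.2.2]
      exact (sub_eq_zero.1 (CStarRing.star_mul_self_eq_zero_iff _ |>.1 h)).symm
    intro i
    apply aux
    rw [hUU, h1]; simp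
  refine ⟨fun i => U i * star (U i), fun ξ => ∑ i, ‖star (U i) ξ‖ ^ 2, ∑ i, ‖star (U i)‖ ^ 2,
    ?_, ?_, ?_, ?_, ?_⟩
  · intro i
    refine ⟨mul_mem (hU i) (star_mem (hU i)), .mul_star_self _, ?_⟩
    rw [mul_assoc, ← mul_assoc (star (U i)), hUU, h1, ← mul_assoc]
    simp [hUe]
  · intro i
    show U i * star (U i) * (U (i + 1) * star (U (i + 1))) = 0
    rw [mul_assoc, ← mul_assoc (star (U i)), hUU, h2]
    simp
  · intro ξ
    rw [ContinuousLinearMap.sum_apply, inner_sum]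
    simp only [inner_mul_star_self]
    push_cast
    rfl
  · intro ξ
    have hsum : ∑ i, star (U i) ξ = ((5 * c : ℝ) : ℂ) • e ξ := by
      simp only [hsU, add_apply, smul_apply, Finset.sum_add_distrib, ← Finset.sum_smul]
      rw [← Complex.ofReal_sum, ← Complex.ofReal_sum, ← Complex.ofReal_sum, hs, ht]
      simp
    have h3 : ‖∑ i, star (U i) ξ‖ ^ 2 ≤ 5 * ∑ i, ‖star (U i) ξ‖ ^ 2 := by
      have h4 : ‖∑ i, star (U i) ξ‖ ≤ ∑ i, ‖star (U i) ξ‖ := norm_sum_le _ _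
      have h5 := sq_sum_le_card_mul_sum_sq (s := Finset.univ) (f := fun i => ‖star (U i) ξ‖)
      simp only [Finset.card_univ, Fintype.card_fin] at h5
      refine le_trans (pow_le_pow_left₀ (norm_nonneg _) h4 2) (by exact_mod_cast h5)
    rw [hsum, norm_smul, Complex.norm_real, mul_pow, Real.norm_eq_abs, sq_abs] at h3
    rw [← hc]
    nlinarith
  · intro ξ
    rw [Finset.sum_mul]
    apply Finset.sum_le_sum
    intro i _
    rw [← mul_pow]
    exact pow_le_pow_left₀ (norm_nonneg _) (ContinuousLinearMap.le_opNorm _ _) 2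

end Aux3

/-- Theorem 4.2: for a type III factor `N` on a separable Hilbert space, any
finite family of normal states `ψ₁, …, ψ_k`, and any `ε ∈ (0, √5 - 2)`, there
are projections `P₀, …, P₄ ∈ N` with `Pᵢ P_{i+1} = 0` (mod 5) such that
`ψ_l(P₀ + ⋯ + P₄) ≥ √5 - ε > 2` for every `l`. -/
theorem typeIII_factor_kcbs_violation_finite_family
    {H : Type*} [NormedAddCommGroup H] [InnerProductSpace ℂ H] [CompleteSpace H]
    [TopologicalSpace.SeparableSpace H]
    (N : VonNeumannAlgebra H) (hN : IsTypeIIIFactor N)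
    (k : ℕ) (ψ : Fin k → (H →L[ℂ] H) → ℂ)
    (hψ : ∀ l, IsNormalState (ψ l))
    (ε : ℝ) (hε : ε ∈ Set.Ioo 0 (Real.sqrt 5 - 2)) :
    ∃ P : Fin 5 → (H →L[ℂ] H),
      (∀ i, IsProjectionIn N (P i)) ∧
      (∀ i, P i * P (i + 1) = 0) ∧
      (2 : ℝ) < Real.sqrt 5 - ε ∧
      ∀ l, ((Real.sqrt 5 - ε : ℝ) : ℂ) ≤ ψ l (∑ i, P i) := by
  classical
  obtain ⟨hε0, hε1⟩ := hε
  choose ξ hξ1 hξ2 using hψ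
  have h2 : (2 : ℝ) < √5 - ε := by linarith
  by_cases h10 : (1 : H →L[ℂ] H) = 0
  · refine ⟨fun _ => 0, fun i => ⟨zero_mem N, .zero _, by simp⟩, by simp, h2, ?_⟩
    intro l
    exfalso
    have : ∀ n, ξ l n = 0 := by
      intro n
      have := congrArg (fun T : H →L[ℂ] H => T (ξ l n)) h10
      simpa using this
    have h := hξ1 l
    simp [this] at h
  have hsum : ∀ l, Summable (fun n => ‖ξ l n‖ ^ 2) := by
    intro l
    by_contra h
    have := tsum_eq_zero_of_not_summable h
    rw [hξ1 l] at this
    norm_num at this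
  have h5p : 0 < √5 := by positivity
  set δ := ε / (2 * √5) with hδ
  have hδp : 0 < δ := by positivity
  have hev : ∀ᶠ M in Filter.atTop, ∀ l, 1 - δ < ∑ n ∈ Finset.range M, ‖ξ l n‖ ^ 2 := by
    rw [Filter.eventually_all]
    intro l
    have := (hsum l).hasSum.tendsto_sum_nat
    rw [hξ1 l] at this
    exact this.eventually_const_lt (by linarith)
  obtain ⟨M, hM⟩ := hev.exists
  have hη : 0 < δ / (M + 1) := by positivity
  obtain ⟨e, W, V, he, hW, hV, hWW, hVV, hWV, heW, heV, hX⟩ := key hN h10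
    (Finset.univ.biUnion fun l => (Finset.range M).image (ξ l)) (Real.sqrt_pos.2 hη)
  obtain ⟨P, g, C, hP, hPP, hg, hg1, hg2⟩ := pentagram_proj he hW hV hWW hVV hWV heW heV
  refine ⟨P, hP, hPP, h2, ?_⟩
  intro l
  rw [hξ2 l]
  simp only [hg]
  rw [← Complex.ofReal_tsum, Complex.real_le_real]
  have hg0 : ∀ x, 0 ≤ g x := fun x => le_trans (by positivity) (hg1 x)
  have hgs : Summable (fun n => g (ξ l n)) :=
    Summable.of_nonneg_of_le (fun n => hg0 _) (fun n => hg2 _) ((hsum l).mul_left C)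
  have h3 : ∑ n ∈ Finset.range M, g (ξ l n) ≤ ∑' n, g (ξ l n) :=
    hgs.sum_le_tsum _ (fun n _ => hg0 _)
  have h4 : ∑ n ∈ Finset.range M, √5 * (‖ξ l n‖ ^ 2 - δ / (M + 1)) ≤
      ∑ n ∈ Finset.range M, g (ξ l n) := by
    apply Finset.sum_le_sum
    intro n hn
    refine le_trans ?_ (hg1 _)
    apply mul_le_mul_of_nonneg_left _ h5p.le
    have h5 := hX (ξ l n) (Finset.mem_biUnion.2
      ⟨l, Finset.mem_univ _, Finset.mem_image_of_mem _ hn⟩)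
    have h6 := proj_contract he.2.1 he.2.2 (ξ l n)
    have h7 := (Real.lt_sqrt (norm_nonneg _)).1 h5
    linarith
  rw [← Finset.mul_sum, Finset.sum_sub_distrib, Finset.sum_const, Finset.card_range,
    nsmul_eq_mul] at h4
  have h8 : (M : ℝ) * (δ / (M + 1)) ≤ δ := by
    rw [mul_div_assoc', div_le_iff₀ (by positivity)]
    nlinarith
  have h9 : √5 * (1 - δ - δ) ≤ √5 * (∑ n ∈ Finset.range M, ‖ξ l n‖ ^ 2 - M * (δ / (M + 1))) := by
    apply mul_le_mul_of_nonneg_left _ h5p.le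
    linarith [hM l]
  have h11 : √5 * (1 - δ - δ) = √5 - ε := by
    rw [hδ]; field_simp; ring
  linarith
end

section
/- Let N be a type III factor on a separable Hilbert space. Then every normal state ψ of N violates the KCBS inequality: there exist projections P_0,...,P_4 ∈ N with P_i P_{i+1} = 0 (mod 5) and ψ(P_0+P_1+P_2+P_3+P_4) > 2. -/
open scoped ComplexOrder InnerProductSpace

section Helpers
variable {H : Type*} [NormedAddCommGroup H] [InnerProductSpace ℂ H] [CompleteSpace H]

lemma inner_star_mul (S T : H →L[ℂ] H) (h k : H) : ⟪h, (star S * T) k⟫_ℂ = ⟪S h, T k⟫_ℂ :=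
  ContinuousLinearMap.adjoint_inner_right S h (T k)

/-- The projection onto the closure of the range of `X`. -/
noncomputable def rangeProj (X : H →L[ℂ] H) : H →L[ℂ] H :=
  (X.range.topologicalClosure).starProjection

lemma rangeProj_mem (N : VonNeumannAlgebra H) {X : H →L[ℂ] H} (hX : X ∈ N) :
    IsProjectionIn N (rangeProj X) := by
  have hs : IsStarProjection (rangeProj X) := isStarProjection_starProjection
  refine ⟨?_, hs.isSelfAdjoint, hs.isIdempotentElem⟩
  rw [VonNeumannAlgebra.IsStarProjection.mem_iff hs]
  intro y hy
  rw [VonNeumannAlgebra.mem_commutant_iff] at hy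
  have h1 := hy X hX
  rw [rangeProj, Submodule.range_starProjection]
  intro x hx
  change y x ∈ X.range.topologicalClosure
  have : Set.MapsTo y (X.range : Set H) (X.range : Set H) := by
    rintro _ ⟨z, rfl⟩
    refine ⟨y z, ?_⟩
    exact congrArg (fun T : H →L[ℂ] H => T z) h1
  exact map_mem_closure y.continuous hx this

lemma rangeProj_apply (X : H →L[ℂ] H) (h : H) : rangeProj X (X h) = X h := by
  apply Submodule.starProjection_eq_self_iff.2
  exact Submodule.le_topologicalClosure _ ⟨h, rfl⟩

lemma rangeProj_mul_zero {X Y : H →L[ℂ] H} (h : star X * Y = 0) :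
    rangeProj X * rangeProj Y = 0 := by
  have h1 : ∀ a b, ⟪X a, Y b⟫_ℂ = 0 := by
    intro a b
    have := congrArg (fun T : H →L[ℂ] H => ⟪a, T b⟫_ℂ) h
    simpa [ContinuousLinearMap.star_eq_adjoint, ContinuousLinearMap.adjoint_inner_right] using this
  have h2 : X.range.topologicalClosure ⟂ Y.range.topologicalClosure := by
    rw [Submodule.isOrtho_iff_le, Submodule.orthogonal_closure]
    apply Submodule.topologicalClosure_minimal _ _ (Submodule.isClosed_orthogonal _)
    rintro _ ⟨a, rfl⟩
    rw [Submodule.mem_orthogonal']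
    rintro _ ⟨b, rfl⟩
    exact h1 a b
  exact (Submodule.starProjection_comp_starProjection_eq_zero_iff).2 h2

lemma abs_mem (N : VonNeumannAlgebra H) {A : H →L[ℂ] H} (hA : A ∈ N) : CFC.abs A ∈ N := by
  rw [← N.commutant_commutant, VonNeumannAlgebra.mem_commutant_iff]
  intro g hg
  have hg' : star g ∈ N.commutant := star_mem hg
  rw [VonNeumannAlgebra.mem_commutant_iff] at hg hg'
  exact (Commute.cfcAbs_right (show Commute A g from hg A hA) (hg' A hA))

lemma abs_sa (A : H →L[ℂ] H) : star (CFC.abs A) = CFC.abs A :=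
  (IsSelfAdjoint.of_nonneg (CFC.abs_nonneg A))

/-- KCBS projections built from three operators with the same modulus and orthogonal ranges. -/
lemma kcbs_of_three (N : VonNeumannAlgebra H) {A B C : H →L[ℂ] H} (hA : A ∈ N) (hB : B ∈ N)
    (hC : C ∈ N) (hBB : star B * B = star A * A) (hCC : star C * C = star A * A)
    (hAB : star A * B = 0) (hAC : star A * C = 0) (hBC : star B * C = 0) :
    ∃ P : Fin 5 → (H →L[ℂ] H), (∀ i, IsProjectionIn N (P i)) ∧
      (∀ i, P i * P (i + 1) = 0) ∧
      ∀ h, 13 / 6 * ‖A h‖ ^ 2 ≤ ∑ i, ‖P i (A h)‖ ^ 2 := by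
  have hBA : star B * A = 0 := by simpa using congrArg star hAB
  have hCA : star C * A = 0 := by simpa using congrArg star hAC
  have hCB : star C * B = 0 := by simpa using congrArg star hBC
  let X : ℤ → ℤ → (H →L[ℂ] H) := fun b c => A + b • B + c • C
  have hX : ∀ b c, X b c ∈ N := fun b c =>
    add_mem (add_mem hA (zsmul_mem hB b)) (zsmul_mem hC c)
  have hXX : ∀ b c b' c', star (X b c) * X b' c' = (1 + b * b' + c * c') • (star A * A) := by
    intro b c b' c'
    simp only [X, star_add, star_zsmul, add_mul, mul_add, smul_mul_assoc, mul_smul_comm, hBB, hCC,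
      hAB, hAC, hBC, hBA, hCA, hCB, smul_zero, add_zero, zero_add, add_smul, one_smul, mul_smul]
    rw [smul_comm b' b, smul_comm c' c]
  have hXA : ∀ b c, star (X b c) * A = star A * A := by
    intro b c
    have := hXX b c 0 0
    simpa [X] using this
  have key : ∀ b c h, ‖A h‖ ^ 2 ≤ (1 + b * b + c * c : ℤ) * ‖rangeProj (X b c) (A h)‖ ^ 2 := by
    intro b c h
    have e1 : ⟪X b c h, A h⟫_ℂ = ⟪A h, A h⟫_ℂ := by
      have := congrArg (fun T : H →L[ℂ] H => ⟪h, T h⟫_ℂ) (hXA b c)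
      simpa only [inner_star_mul] using this
    have e2 : ⟪X b c h, X b c h⟫_ℂ = ((1 + b * b + c * c : ℤ) : ℂ) * ⟪A h, A h⟫_ℂ := by
      have := congrArg (fun T : H →L[ℂ] H => ⟪h, T h⟫_ℂ) (hXX b c b c)
      simp only [← Int.cast_smul_eq_zsmul ℂ, smul_apply, inner_smul_right] at this
      simpa only [inner_star_mul] using this
    have e2' : ‖X b c h‖ ^ 2 = (1 + b * b + c * c : ℤ) * ‖A h‖ ^ 2 := by
      rw [inner_self_eq_norm_sq_to_K, inner_self_eq_norm_sq_to_K] at e2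
      apply Complex.ofReal_injective
      push_cast at e2 ⊢
      exact e2
    have e3 : ⟪X b c h, rangeProj (X b c) (A h)⟫_ℂ = ⟪X b c h, A h⟫_ℂ := by
      have := (rangeProj_mem N (hX b c)).2.1
      have h4 := (ContinuousLinearMap.isSelfAdjoint_iff_isSymmetric.1 this) (X b c h) (A h)
      simp only [ContinuousLinearMap.coe_coe] at h4
      rw [← h4, rangeProj_apply]
    have e4 := norm_inner_le_norm (𝕜 := ℂ) (X b c h) (rangeProj (X b c) (A h))
    rw [e3, e1, inner_self_eq_norm_sq_to_K] at e4
    have e5 : ‖A h‖ ^ 2 ≤ ‖X b c h‖ * ‖rangeProj (X b c) (A h)‖ := by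
      simpa using e4
    rcases eq_or_ne (A h) 0 with h0 | h0
    · simp [h0]
    have hp : 0 < ‖A h‖ ^ 2 := by positivity
    have e6 : (‖A h‖ ^ 2) ^ 2 ≤ ‖X b c h‖ ^ 2 * ‖rangeProj (X b c) (A h)‖ ^ 2 := by
      rw [← mul_pow]; gcongr
    rw [e2'] at e6
    nlinarith
  refine ⟨fun i => rangeProj (X ((![1, -1, 0, 0, -1] : Fin 5 → ℤ) i)
    ((![0, -1, 1, -1, 1] : Fin 5 → ℤ) i)), fun i => rangeProj_mem N (hX _ _), ?_, ?_⟩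
  · intro i
    apply rangeProj_mul_zero
    rw [hXX]
    fin_cases i <;> simp
  · intro h
    have k0 := key 1 0 h
    have k1 := key (-1) (-1) h
    have k2 := key 0 1 h
    have k3 := key 0 (-1) h
    have k4 := key (-1) 1 h
    norm_num at k0 k1 k2 k3 k4
    simp [Fin.sum_univ_five]
    linarith

lemma dense_of_factor (N : VonNeumannAlgebra H) (hN : IsFactor N) {r : H →L[ℂ] H} (hr : r ∈ N)
    (hr0 : r ≠ 0) :
    (⨆ a : N, ((a : H →L[ℂ] H) * r).range).topologicalClosure = ⊤ := by
  set Z := ⨆ a : N, ((a : H →L[ℂ] H) * r).range with hZ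
  set z := Z.topologicalClosure.starProjection with hz
  have hs : IsStarProjection z := isStarProjection_starProjection
  have inv : ∀ y : H →L[ℂ] H, (∀ x ∈ Z, y x ∈ Z) →
      z.range ∈ Module.End.invtSubmodule (y : H →ₗ[ℂ] H) := by
    intro y hy
    rw [hz, Submodule.range_starProjection]
    intro x hx
    exact map_mem_closure y.continuous hx hy
  have invS : ∀ y : H →L[ℂ] H, (∀ (a : N) x, y (((a : H →L[ℂ] H) * r) x) ∈ Z) →
      ∀ x ∈ Z, y x ∈ Z := by
    intro y hy
    have : Z ≤ Z.comap (y : H →ₗ[ℂ] H) := by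
      rw [hZ]
      apply iSup_le
      rintro a _ ⟨x, rfl⟩
      exact hy a x
    exact this
  have memZ : ∀ (a : N) x, ((a : H →L[ℂ] H) * r) x ∈ Z := fun a x =>
    (le_iSup (fun a : N => ((a : H →L[ℂ] H) * r).range) a) ⟨x, rfl⟩
  have hzN : z ∈ N := by
    rw [VonNeumannAlgebra.IsStarProjection.mem_iff hs]
    intro y hy
    rw [VonNeumannAlgebra.mem_commutant_iff] at hy
    apply inv _ (invS _ _)
    intro a x
    have := congrArg (fun T : H →L[ℂ] H => T x) (hy _ (mul_mem a.2 hr)).symm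
    have h2 := memZ a (y x)
    change y _ = _ at this
    exact this ▸ h2
  have hzN' : z ∈ N.commutant := by
    rw [VonNeumannAlgebra.IsStarProjection.mem_iff hs]
    intro y hy
    rw [VonNeumannAlgebra.commutant_commutant] at hy
    apply inv _ (invS _ _)
    intro a x
    exact memZ (⟨y, hy⟩ * a) x
  rw [VonNeumannAlgebra.mem_commutant_iff] at hzN'
  obtain ⟨c, hc⟩ := hN z hzN (fun y hy => (hzN' y hy).symm)
  obtain ⟨x, hx⟩ : ∃ x, r x ≠ 0 := by
    by_contra! hcon
    exact hr0 (ContinuousLinearMap.ext hcon)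
  have h1 : z (r x) = r x := by
    apply Submodule.starProjection_eq_self_iff.2
    apply Submodule.le_topologicalClosure
    simpa using memZ 1 x
  have hc1 : c = 1 := by
    rw [hc] at h1
    simp only [smul_apply, one_apply_eq_self] at h1
    have : (c - 1) • r x = 0 := by rw [sub_smul, h1]; simp
    rcases smul_eq_zero.1 this with h | h
    · exact sub_eq_zero.1 h
    · exact absurd h hx
  rw [Submodule.eq_top_iff']
  intro y
  apply Submodule.starProjection_eq_self_iff.1
  rw [← hz, hc, hc1]; simp

lemma iso_pow {v : H →L[ℂ] H} (hv : star v * v = 1) (n : ℕ) : star v ^ n * v ^ n = 1 := by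
  induction n with
  | zero => simp
  | succ n ih =>
    calc star v ^ (n + 1) * v ^ (n + 1) = star v ^ n * (star v * v) * v ^ n := by
          rw [pow_succ, pow_succ']; simp only [mul_assoc]
      _ = 1 := by rw [hv, mul_one, ih]

/-- The final projection of `v ^ n`. -/
noncomputable def fin_pr (v : H →L[ℂ] H) (n : ℕ) : H →L[ℂ] H := v ^ n * star v ^ n

lemma fin_pr_star (v : H →L[ℂ] H) (n : ℕ) : star (fin_pr v n) = fin_pr v n := by
  simp [fin_pr]

lemma fin_pr_mul {v : H →L[ℂ] H} (hv : star v * v = 1) (a b : ℕ) :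
    fin_pr v a * fin_pr v (a + b) = fin_pr v (a + b) := by
  calc fin_pr v a * fin_pr v (a + b)
      = v ^ a * (star v ^ a * v ^ a) * v ^ b * star v ^ (a + b) := by
        simp only [fin_pr]; rw [pow_add v]; simp only [mul_assoc]
    _ = _ := by rw [iso_pow hv, mul_one, ← pow_add, fin_pr]

lemma fin_pr_mul' {v : H →L[ℂ] H} (hv : star v * v = 1) (a b : ℕ) :
    fin_pr v (a + b) * fin_pr v a = fin_pr v (a + b) := by
  simpa [fin_pr_star] using congrArg star (fin_pr_mul hv a b)

lemma pow_fin_pr {v : H →L[ℂ] H} (hv : star v * v = 1) (k n : ℕ) :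
    v ^ k * fin_pr v n = fin_pr v (n + k) * v ^ k := by
  calc v ^ k * fin_pr v n = v ^ k * v ^ n * star v ^ n * (star v ^ k * v ^ k) := by
        rw [iso_pow hv]; simp [fin_pr, mul_assoc]
    _ = _ := by rw [fin_pr, ← pow_add, pow_add (star v), add_comm k n]; simp only [mul_assoc]

lemma fin_pr_mem (N : VonNeumannAlgebra H) {v : H →L[ℂ] H} (h : v ∈ N) (n : ℕ) :
    fin_pr v n ∈ N := mul_mem (pow_mem h n) (pow_mem (star_mem h) n)

lemma kcbs_of_op (N : VonNeumannAlgebra H) {v T : H →L[ℂ] H} (hvN : v ∈ N)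
    (hv : star v * v = 1) (hT : T ∈ N) (K M : ℕ)
    (hTs : T * (fin_pr v M - fin_pr v (M + K)) = T) :
    ∃ P : Fin 5 → (H →L[ℂ] H), (∀ i, IsProjectionIn N (P i)) ∧
      (∀ i, P i * P (i + 1) = 0) ∧
      ∀ h, 13 / 6 * ‖T h - (fin_pr v M - fin_pr v (M + K + K)) (T h)‖ ^ 2 ≤
        ∑ i, ‖P i (T h - (fin_pr v M - fin_pr v (M + K + K)) (T h))‖ ^ 2 := by
  have haa := fin_pr_mul hv M 0
  have hbb := fin_pr_mul hv (M + K) 0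
  have hcc := fin_pr_mul hv (M + K + K) 0
  have hab := fin_pr_mul hv M K
  have hba := fin_pr_mul' hv M K
  have hbc := fin_pr_mul hv (M + K) K
  have hcb := fin_pr_mul' hv (M + K) K
  have hac := fin_pr_mul hv M (K + K)
  have hca := fin_pr_mul' hv M (K + K)
  have hWa := pow_fin_pr hv K M
  have hWb := pow_fin_pr hv K (M + K)
  have sa := fin_pr_star v M
  have sb := fin_pr_star v (M + K)
  have sc := fin_pr_star v (M + K + K)
  have ma := fin_pr_mem N hvN M
  have mc := fin_pr_mem N hvN (M + K + K)
  have hWW := iso_pow hv K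
  have hWN : v ^ K ∈ N := pow_mem hvN K
  rw [← add_assoc] at hac hca
  simp only [add_zero] at haa hbb hcc
  generalize fin_pr v M = a at *
  generalize fin_pr v (M + K) = b at *
  generalize fin_pr v (M + K + K) = c at *
  rw [← star_pow] at hWW
  generalize v ^ K = W at *
  have hqs : (1 - (a - c)) * (a - b) = 0 := by
    simp only [sub_mul, mul_sub, one_mul, haa, hab, hca, hcb]; abel
  have hWs : W * (a - b) = (b - c) * W := by rw [mul_sub, hWa, hWb, sub_mul]
  have hqWs : (1 - (a - c)) * (W * (a - b)) = 0 := by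
    rw [hWs, ← mul_assoc]
    have : (1 - (a - c)) * (b - c) = 0 := by
      simp only [sub_mul, mul_sub, one_mul, hab, hac, hcb, hcc]; abel
    rw [this, zero_mul]
  have hsWs : (a - b) * (W * (a - b)) = 0 := by
    rw [hWs, ← mul_assoc]
    have : (a - b) * (b - c) = 0 := by
      simp only [sub_mul, mul_sub, hab, hac, hbb, hbc]; abel
    rw [this, zero_mul]
  have hss : star (a - b) = a - b := by simp [sa, sb]
  have hqq : star (1 - (a - c)) = 1 - (a - c) := by simp [sa, sc]
  have mq : 1 - (a - c) ∈ N := sub_mem (one_mem _) (sub_mem ma mc)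
  generalize hs : a - b = s at *
  have key : ∀ h, T h - (a - c) (T h) = ((1 - (a - c)) * T) h := fun h => by
    simp
  simp only [key]
  generalize 1 - (a - c) = q at *
  have hA : q * T ∈ N := mul_mem mq hT
  have hAs : q * T * s = q * T := by rw [mul_assoc, hTs]
  have hsA : star (q * T) = star T * q := by rw [star_mul, hqq]
  have hBB := CFC.abs_mul_abs (q * T)
  have hBsa := abs_sa (q * T)
  have hBN := abs_mem N hA
  generalize CFC.abs (q * T) = B at *
  have hBs : B * s = B := by
    have : star (B * (1 - s)) * (B * (1 - s)) = 0 := by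
      calc star (B * (1 - s)) * (B * (1 - s)) = star (1 - s) * (B * B) * (1 - s) := by
            rw [star_mul, hBsa]; simp only [mul_assoc]
        _ = star (1 - s) * star (q * T) * (q * T * (1 - s)) := by
            rw [hBB]; simp only [mul_assoc]
        _ = 0 := by rw [mul_sub (q * T), hAs]; simp
    rw [CStarRing.star_mul_self_eq_zero_iff, mul_sub, mul_one, sub_eq_zero] at this
    exact this.symm
  have hsB : s * B = B := by simpa [hBsa, hss] using congrArg star hBs
  refine kcbs_of_three N hA hBN (mul_mem hWN hBN) ?_ ?_ ?_ ?_ ?_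
  · rw [hBsa, hBB]
  · rw [star_mul, hBsa, ← hBB]
    calc B * star W * (W * B) = B * (star W * W) * B := by simp only [mul_assoc]
      _ = _ := by rw [hWW, mul_one]
  · rw [hsA, ← hsB]
    calc star T * q * (s * B) = star T * (q * s) * B := by simp only [mul_assoc]
      _ = 0 := by rw [hqs]; simp
  · rw [hsA, ← hsB]
    calc star T * q * (W * (s * B)) = star T * (q * (W * s)) * B := by simp only [mul_assoc]
      _ = 0 := by rw [hqWs]; simp
  · rw [hBsa]
    calc B * (W * B) = (B * s) * (W * (s * B)) := by rw [hBs, hsB]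
      _ = B * (s * (W * s)) * B := by simp only [mul_assoc]
      _ = 0 := by rw [hsWs]; simp

lemma norm_fin_pr_sub_sq {v : H →L[ℂ] H} (hv : star v * v = 1) (n k : ℕ) (x : H) :
    ‖(fin_pr v n - fin_pr v (n + k)) x‖ ^ 2 = ‖(star v ^ n) x‖ ^ 2 - ‖(star v ^ (n + k)) x‖ ^ 2 := by
  have e : star (fin_pr v n - fin_pr v (n + k)) * (fin_pr v n - fin_pr v (n + k)) =
      star (star v ^ n) * star v ^ n - star (star v ^ (n + k)) * star v ^ (n + k) := by
    have h0 := fin_pr_mul hv n 0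
    have h1 := fin_pr_mul hv (n + k) 0
    simp only [add_zero] at h0 h1
    simp only [star_sub, fin_pr_star, sub_mul, mul_sub, fin_pr_mul hv, fin_pr_mul' hv, h0, h1]
    simp [fin_pr]
  have := congrArg (fun T : H →L[ℂ] H => ⟪x, T x⟫_ℂ) e
  simp only [sub_apply, inner_sub_right] at this
  simp only [inner_star_mul, inner_self_eq_norm_sq_to_K] at this
  apply Complex.ofReal_injective
  rw [Complex.ofReal_sub, Complex.ofReal_pow, Complex.ofReal_pow, Complex.ofReal_pow]
  exact this

lemma tendsto_sub {v : H →L[ℂ] H} (hv : star v * v = 1) (k : ℕ) (x : H) :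
    Filter.Tendsto (fun n => ‖(fin_pr v n - fin_pr v (n + k)) x‖) Filter.atTop (nhds 0) := by
  let f : ℕ → ℝ := fun n => ‖(star v ^ n) x‖ ^ 2
  have hf : Antitone f := by
    intro m n hmn
    obtain ⟨j, rfl⟩ := Nat.exists_eq_add_of_le hmn
    have := norm_fin_pr_sub_sq hv m j x
    have h2 := sq_nonneg ‖(fin_pr v m - fin_pr v (m + j)) x‖
    simp only [f]; linarith
  have hb : BddBelow (Set.range f) := ⟨0, by rintro _ ⟨n, rfl⟩; positivity⟩
  have h1 := tendsto_atTop_ciInf hf hb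
  have h2 := h1.comp (Filter.tendsto_add_atTop_nat k)
  have h3 := (h1.sub h2).sqrt
  simp only [sub_self, Real.sqrt_zero] at h3
  refine h3.congr fun n => ?_
  simp only [Function.comp, f]
  rw [← norm_fin_pr_sub_sq hv, Real.sqrt_sq (norm_nonneg _)]

lemma build_op (N : VonNeumannAlgebra H) {v : H →L[ℂ] H} (hvN : v ∈ N)
    (hv : star v * v = 1) (F : Finset N) :
    ∃ K, ∃ T ∈ N, T * fin_pr v K = 0 ∧ ∀ μ : N → H, ∃ h,
      T h = ∑ a ∈ F, ((a : H →L[ℂ] H) * (1 - v * star v)) (μ a) := by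
  classical
  obtain ⟨c, hc, hinj⟩ : ∃ c : N → ℕ, (∀ a ∈ F, c a < F.card) ∧
      ∀ a ∈ F, ∀ b ∈ F, c a = c b → a = b := by
    refine ⟨fun a => if h : a ∈ F then F.equivFin ⟨a, h⟩ else 0, ?_, ?_⟩
    · intro a ha; simp [ha]
    · intro a ha b hb hab
      simp only [ha, hb, dif_pos] at hab
      simpa using F.equivFin.injective (Fin.ext hab)
  set r := 1 - v * star v with hr
  have hrs : star r = r := by simp [hr]
  have hrv : r * v = 0 := by rw [hr, sub_mul, mul_assoc, hv]; simp
  have hrr : r * r = r := by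
    nth_rw 2 [hr]; rw [mul_sub, ← mul_assoc, hrv]; simp
  have hlt : ∀ i j, i < j → r * star v ^ i * v ^ j = 0 := by
    intro i j hij
    obtain ⟨l, rfl⟩ := Nat.exists_eq_add_of_lt hij
    calc r * star v ^ i * v ^ (i + l + 1) = r * (star v ^ i * v ^ i) * v * v ^ l := by
          rw [add_assoc, pow_add v, pow_succ']; simp only [mul_assoc]
      _ = 0 := by rw [iso_pow hv, mul_one, hrv, zero_mul]
  have hgt : ∀ i j, j < i → r * star v ^ i * (v ^ j * r) = 0 := by
    intro i j hij
    have := congrArg star (hlt j i hij)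
    simp only [star_mul, star_pow, star_star, hrs, star_zero] at this
    rw [mul_assoc, this, mul_zero]
  have heq : ∀ i, r * star v ^ i * (v ^ i * r) = r := by
    intro i
    calc r * star v ^ i * (v ^ i * r) = r * (star v ^ i * v ^ i) * r := by
          simp only [mul_assoc]
      _ = r := by rw [iso_pow hv, mul_one, hrr]
  have hrN : r ∈ N := sub_mem (one_mem _) (mul_mem hvN (star_mem hvN))
  refine ⟨F.card, ∑ a ∈ F, (a : H →L[ℂ] H) * (r * star v ^ c a), ?_, ?_, ?_⟩
  · exact sum_mem fun a _ => mul_mem a.2 (mul_mem hrN (pow_mem (star_mem hvN) _))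
  · rw [Finset.sum_mul]
    refine Finset.sum_eq_zero fun a ha => ?_
    rw [fin_pr, mul_assoc, ← mul_assoc (r * _), hlt _ _ (hc a ha)]
    simp
  · intro μ
    refine ⟨∑ b ∈ F, (v ^ c b * r) (μ b), ?_⟩
    rw [sum_apply]
    refine Finset.sum_congr rfl fun a ha => ?_
    rw [map_sum, Finset.sum_eq_single a]
    · change ((a : H →L[ℂ] H) * ((r * star v ^ c a) * (v ^ c a * r))) (μ a) = _
      rw [heq]
    · intro b hb hba
      change ((a : H →L[ℂ] H) * ((r * star v ^ c a) * (v ^ c b * r))) (μ b) = _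
      rcases lt_trichotomy (c a) (c b) with h | h | h
      · rw [← mul_assoc (r * _), hlt _ _ h]; simp
      · exact absurd (hinj a ha b hb h).symm hba
      · rw [hgt _ _ h]; simp
    · intro h; exact absurd ha h

/-- Approximation: finitely many vectors can be handled at once. -/
lemma kcbs_approx (N : VonNeumannAlgebra H) (hN : IsFactor N) {v : H →L[ℂ] H} (hvN : v ∈ N)
    (hv : star v * v = 1) (hv1 : v * star v ≠ 1) (ξ : ℕ → H) (m : ℕ) {δ : ℝ} (hδ : 0 < δ) :
    ∃ P : Fin 5 → (H →L[ℂ] H), (∀ i, IsProjectionIn N (P i)) ∧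
      (∀ i, P i * P (i + 1) = 0) ∧
      ∀ n < m, ∃ y, ‖ξ n - y‖ ≤ δ ∧ 13 / 6 * ‖y‖ ^ 2 ≤ ∑ i, ‖P i y‖ ^ 2 := by
  classical
  have hrN : 1 - v * star v ∈ N := sub_mem (one_mem _) (mul_mem hvN (star_mem hvN))
  have hd := dense_of_factor N hN hrN (sub_ne_zero.2 hv1.symm)
  have h1 : ∀ n, ∃ x ∈ ⨆ a : N, ((a : H →L[ℂ] H) * (1 - v * star v)).range,
      ‖ξ n - x‖ < δ / 2 := by
    intro n
    have : ξ n ∈ (⨆ a : N, ((a : H →L[ℂ] H) * (1 - v * star v)).range).topologicalClosure := by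
      rw [hd]; trivial
    obtain ⟨x, hx, hx2⟩ := Metric.mem_closure_iff.1 this (δ / 2) (by positivity)
    exact ⟨x, hx, by rwa [← dist_eq_norm]⟩
  choose x hx hxδ using h1
  have h2 := fun n => Submodule.mem_iSup_iff_exists_finset.1 (hx n)
  choose G hG using h2
  let F := (Finset.range m).biUnion G
  obtain ⟨K, T, hTN, hTK, hT⟩ := build_op N hvN hv F
  have h3 : ∀ n < m, ∃ h, T h = x n := by
    intro n hn
    have : x n ∈ ⨆ a ∈ F, ((a : H →L[ℂ] H) * (1 - v * star v)).range := by
      have hle : (⨆ a ∈ G n, ((a : H →L[ℂ] H) * (1 - v * star v)).range) ≤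
          ⨆ a ∈ F, ((a : H →L[ℂ] H) * (1 - v * star v)).range :=
        biSup_mono fun a ha => Finset.mem_biUnion.2 ⟨n, Finset.mem_range.2 hn, ha⟩
      exact hle (hG n)
    obtain ⟨μ, hμ⟩ := (Submodule.mem_iSup_finset_iff_exists_sum _ _).1 this
    choose ν hν using fun a => (μ a).2
    obtain ⟨h, hh⟩ := hT ν
    refine ⟨h, ?_⟩
    rw [hh, ← hμ]
    exact Finset.sum_congr rfl fun a _ => hν a
  have h4 : ∀ᶠ M in Filter.atTop, ∀ n ∈ Finset.range m,
      ‖(fin_pr v M - fin_pr v (M + (K + K))) (ξ n)‖ < δ / 2 := by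
    rw [Filter.eventually_all_finset]
    intro n _
    exact (tendsto_sub hv (K + K) (ξ n)).eventually_lt_const (by positivity)
  obtain ⟨M, hM⟩ := h4.exists
  have hTs : T * star v ^ M * (fin_pr v M - fin_pr v (M + K)) = T * star v ^ M := by
    have e := congrArg star (pow_fin_pr hv M K)
    simp only [star_mul, fin_pr_star, star_pow] at e
    have e0 := congrArg star (pow_fin_pr hv M 0)
    simp only [star_mul, fin_pr_star, star_pow, zero_add] at e0
    rw [add_comm M K, mul_assoc, mul_sub, ← e, ← e0, mul_sub, ← mul_assoc T (fin_pr v K), hTK]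
    simp [fin_pr]
  obtain ⟨P, hP, hPP, hPh⟩ := kcbs_of_op N hvN hv (mul_mem hTN (pow_mem (star_mem hvN) M)) K M hTs
  refine ⟨P, hP, hPP, fun n hn => ?_⟩
  obtain ⟨h, hh⟩ := h3 n hn
  have h5 := hPh ((v ^ M) h)
  have h6 : (T * star v ^ M) ((v ^ M) h) = x n := by
    change (T * star v ^ M * v ^ M) h = _
    rw [mul_assoc, iso_pow hv, mul_one, hh]
  rw [h6] at h5
  refine ⟨_, ?_, h5⟩
  have h7 := hM n (Finset.mem_range.2 hn)
  rw [← add_assoc] at h7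
  set q := fin_pr v M - fin_pr v (M + K + K) with hq
  have hc : ‖(ξ n - x n) - q (ξ n - x n)‖ ≤ ‖ξ n - x n‖ := by
    have hq2 : star (1 - q) * (1 - q) = 1 - star q * q := by
      have h0 := fin_pr_mul hv M 0
      have h1 := fin_pr_mul hv (M + K + K) 0
      have h2 := fin_pr_mul hv M (K + K)
      have h3 := fin_pr_mul' hv M (K + K)
      rw [← add_assoc] at h2 h3
      simp only [add_zero] at h0 h1
      simp only [hq, star_sub, fin_pr_star, sub_mul, mul_sub, h0, h1, h2, h3, star_one, one_mul,
        mul_one]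
      abel
    generalize ξ n - x n = w
    have := congrArg (fun T : H →L[ℂ] H => ⟪w, T w⟫_ℂ) hq2
    simp only [sub_apply, inner_sub_right] at this
    simp only [inner_star_mul, inner_self_eq_norm_sq_to_K,
      one_apply_eq_self] at this
    have h8 : ‖(1 - q) w‖ ^ 2 = ‖w‖ ^ 2 - ‖q w‖ ^ 2 := by
      apply Complex.ofReal_injective
      push_cast
      exact this
    have h9 : w - q w = (1 - q) w := by simp
    rw [h9]
    apply le_of_sq_le_sq _ (norm_nonneg _)
    nlinarith [sq_nonneg ‖q w‖]
  have e : ξ n - (x n - q (x n)) = q (ξ n) + ((ξ n - x n) - q (ξ n - x n)) := by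
    rw [map_sub]; abel
  rw [e]
  have := norm_add_le (q (ξ n)) ((ξ n - x n) - q (ξ n - x n))
  linarith [hxδ n]

end Helpers

/-- Corollary 4.3: every normal state of a type III factor on a separable
Hilbert space violates the KCBS inequality: there are projections
`P₀, …, P₄ ∈ N` with `Pᵢ P_{i+1} = 0` (mod 5) and `ψ(P₀ + ⋯ + P₄) > 2`. -/
theorem typeIII_factor_every_normal_state_violates_kcbs
    {H : Type*} [NormedAddCommGroup H] [InnerProductSpace ℂ H] [CompleteSpace H]
    [TopologicalSpace.SeparableSpace H]
    (N : VonNeumannAlgebra H) (hN : IsTypeIIIFactor N)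
    (ψ : (H →L[ℂ] H) → ℂ) (hψ : IsNormalState ψ) :
    ∃ P : Fin 5 → (H →L[ℂ] H),
      (∀ i, IsProjectionIn N (P i)) ∧
      (∀ i, P i * P (i + 1) = 0) ∧
      (2 : ℂ) < ψ (∑ i, P i) := by
  obtain ⟨ξ, hξ, hψ⟩ := hψ
  have hsum : Summable fun n => ‖ξ n‖ ^ 2 := by
    by_contra h
    rw [tsum_eq_zero_of_not_summable h] at hξ
    exact zero_ne_one hξ
  have h10 : (1 : H →L[ℂ] H) ≠ 0 := by
    intro h
    have : ∀ n, ξ n = 0 := fun n => by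
      simpa using congrArg (fun T : H →L[ℂ] H => T (ξ n)) h
    simp [this] at hξ
  obtain ⟨v, hvN, hv, -, hv1⟩ := hN.2 1 ⟨one_mem _, IsSelfAdjoint.one _, one_mul 1⟩ h10
  have hs : HasSum (fun n => ‖ξ n‖ ^ 2) 1 := hξ ▸ hsum.hasSum
  obtain ⟨m, hm⟩ := (hs.tendsto_sum_nat.eventually_const_lt
    (show (25 / 26 : ℝ) < 1 by norm_num)).exists
  have hle1 : ∀ n, ‖ξ n‖ ≤ 1 := by
    intro n
    have := hs.summable.le_tsum n (fun j _ => sq_nonneg _)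
    rw [hξ] at this
    nlinarith [norm_nonneg (ξ n)]
  set δ : ℝ := 1 / (1000 * (m + 1)) with hδ
  have hδ0 : 0 < δ := by positivity
  have hmδ : m * δ ≤ 1 / 1000 := by
    rw [hδ]
    rw [mul_one_div, div_le_div_iff₀ (by positivity) (by norm_num)]
    linarith
  have hδ1 : δ ≤ 1 := by
    rw [hδ, div_le_one (by positivity)]
    have : (0 : ℝ) ≤ m := by positivity
    linarith
  obtain ⟨P, hP, hPP, hPy⟩ := kcbs_approx N hN.1 hvN hv hv1 ξ m hδ0
  refine ⟨P, hP, hPP, ?_⟩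
  have hcontr : ∀ i x, ‖P i x‖ ≤ ‖x‖ := by
    intro i x
    have hs : IsStarProjection (P i) := ⟨(hP i).2.2, (hP i).2.1⟩
    have h1 : ‖P i‖ ≤ 1 := hs.norm_le
    simpa using (P i).le_of_opNorm_le h1 x
  have hval : ∀ i x, ⟪x, P i x⟫_ℂ = ((‖P i x‖ ^ 2 : ℝ) : ℂ) := by
    intro i x
    have h : star (P i) * P i = P i := by rw [(hP i).2.1.star_eq, (hP i).2.2]
    have := inner_star_mul (P i) (P i) x x
    rw [h, inner_self_eq_norm_sq_to_K] at this
    rw [this]; push_cast; rfl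
  have hψP : ψ (∑ i, P i) = ((∑' n, ∑ i, ‖P i (ξ n)‖ ^ 2 : ℝ) : ℂ) := by
    rw [hψ, Complex.ofReal_tsum]
    refine tsum_congr fun n => ?_
    rw [sum_apply, inner_sum]
    simp only [hval]
    push_cast; rfl
  rw [hψP]
  have hS : Summable fun n => ∑ i, ‖P i (ξ n)‖ ^ 2 := by
    refine Summable.of_nonneg_of_le (fun n => by positivity) (fun n => ?_) (hsum.mul_left 5)
    calc ∑ i, ‖P i (ξ n)‖ ^ 2 ≤ ∑ i : Fin 5, ‖ξ n‖ ^ 2 := by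
          gcongr with i; exact hcontr i _
      _ = 5 * ‖ξ n‖ ^ 2 := by simp
  have hlow : ∀ n < m, 13 / 6 * ‖ξ n‖ ^ 2 - 25 * δ ≤ ∑ i, ‖P i (ξ n)‖ ^ 2 := by
    intro n hn
    obtain ⟨y, hy, hy2⟩ := hPy n hn
    have hn1 := norm_sub_norm_le (ξ n) y
    have hn2 : ‖y‖ ≤ 1 + δ := by
      have := norm_sub_norm_le y (ξ n)
      rw [norm_sub_rev] at this
      linarith [hle1 n]
    have h1 : ∀ i, ‖P i y‖ ^ 2 - 4 * δ ≤ ‖P i (ξ n)‖ ^ 2 := by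
      intro i
      have a1 := norm_sub_norm_le (P i y) (P i (ξ n))
      rw [← map_sub] at a1
      have a2 := hcontr i (y - ξ n)
      rw [norm_sub_rev y] at a2
      have a3 := hcontr i y
      have a4 := norm_nonneg (P i y)
      have a5 := norm_nonneg (P i (ξ n))
      have a6 : ‖P i y‖ - δ ≤ ‖P i (ξ n)‖ := by linarith
      rcases le_total ‖P i y‖ δ with h | h
      · nlinarith
      · have : (‖P i y‖ - δ) ^ 2 ≤ ‖P i (ξ n)‖ ^ 2 := by
          apply pow_le_pow_left₀ (by linarith) a6
        nlinarith
    have h2 : ∑ i, (‖P i y‖ ^ 2 - 4 * δ) ≤ ∑ i, ‖P i (ξ n)‖ ^ 2 :=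
      Finset.sum_le_sum fun i _ => h1 i
    rw [Finset.sum_sub_distrib] at h2
    simp at h2
    have h3 : ‖ξ n‖ ^ 2 - 2 * δ ≤ ‖y‖ ^ 2 := by
      have := norm_nonneg (ξ n)
      have := norm_nonneg y
      have h := hle1 n
      rcases le_total ‖ξ n‖ δ with h' | h'
      · nlinarith
      · have : (‖ξ n‖ - δ) ^ 2 ≤ ‖y‖ ^ 2 := pow_le_pow_left₀ (by linarith) (by linarith) _
        nlinarith
    linarith
  have hfin : (2 : ℝ) < ∑' n, ∑ i, ‖P i (ξ n)‖ ^ 2 := by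
    have h1 := hS.sum_le_tsum (Finset.range m) (fun n _ => by positivity)
    have h2 : ∑ n ∈ Finset.range m, (13 / 6 * ‖ξ n‖ ^ 2 - 25 * δ) ≤
        ∑ n ∈ Finset.range m, ∑ i, ‖P i (ξ n)‖ ^ 2 :=
      Finset.sum_le_sum fun n hn => hlow n (Finset.mem_range.1 hn)
    rw [Finset.sum_sub_distrib, ← Finset.mul_sum] at h2
    simp at h2
    linarith
  exact_mod_cast hfin
end
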